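/- Let n ≥ 2 and 0 < δ < n. For every p > δ/n there exists a constant c depending only on n, δ, and p such that for every f ∈ L¹_loc(ℝⁿ): ∫_{ℝⁿ} (M f(x))^p dH^δ_∞ ≤ c ∫_{ℝⁿ} |f(x)|^p dH^δ_∞. -/

import Mathlib

open MeasureTheory Metric Set Bornology
open scoped ENNReal NNReal

/-- The `δ`-dimensional Hausdorff content of a set `E ⊆ ℝⁿ`, defined as the infimum of
`∑ᵢ rᵢ^δ` over all countable coverings of `E` by open balls `B(xᵢ, rᵢ)`. -/
noncomputable def hContent (n : ℕ) (δ : ℝ) (E : Set (EuclideanSpace ℝ (Fin n))) : ℝ≥0∞ :=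
  ⨅ (x : ℕ → EuclideanSpace ℝ (Fin n)) (r : ℕ → ℝ≥0)
    (_ : E ⊆ ⋃ i, Metric.ball (x i) (r i)), ∑' i, (r i : ℝ≥0∞) ^ δ

/-- The `δ`-dimensional Hausdorff measure of `E ⊆ ℝⁿ`, obtained from coverings by open balls of
radii at most `ρ`, in the limit `ρ → 0⁺` (equivalently: the supremum over `ρ > 0`, since the
infima increase as `ρ` decreases). -/
noncomputable def hMeasure (n : ℕ) (δ : ℝ) (E : Set (EuclideanSpace ℝ (Fin n))) : ℝ≥0∞ :=
  ⨆ (ρ : ℝ≥0) (_ : 0 < ρ),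
    ⨅ (x : ℕ → EuclideanSpace ℝ (Fin n)) (r : ℕ → ℝ≥0)
      (_ : E ⊆ ⋃ i, Metric.ball (x i) (r i)) (_ : ∀ i, r i ≤ ρ), ∑' i, (r i : ℝ≥0∞) ^ δ

/-- The Choquet integral `∫_Ω f dH^δ_∞ = ∫₀^∞ H^δ_∞({x ∈ Ω : f x > t}) dt` of a
(nonnegative) real-valued function with respect to the Hausdorff content. -/
noncomputable def choquet (n : ℕ) (δ : ℝ) (Ω : Set (EuclideanSpace ℝ (Fin n)))
    (f : EuclideanSpace ℝ (Fin n) → ℝ) : ℝ≥0∞ :=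
  ∫⁻ t in Set.Ioi (0 : ℝ), hContent n δ {x ∈ Ω | t < f x}

/-- The Choquet integral of an `[0,∞]`-valued function with respect to the Hausdorff content. -/
noncomputable def echoquet (n : ℕ) (δ : ℝ) (Ω : Set (EuclideanSpace ℝ (Fin n)))
    (f : EuclideanSpace ℝ (Fin n) → ℝ≥0∞) : ℝ≥0∞ :=
  ∫⁻ t in Set.Ioi (0 : ℝ), hContent n δ {x ∈ Ω | ENNReal.ofReal t < f x}

/-- The centered fractional Hardy–Littlewood maximal function
`M_κ f (x) = sup_{r>0} r^{κ-n} ∫_{B(x,r)} |f|`. -/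
noncomputable def fracMaximal (n : ℕ) (κ : ℝ) (f : EuclideanSpace ℝ (Fin n) → ℝ)
    (x : EuclideanSpace ℝ (Fin n)) : ℝ≥0∞ :=
  ⨆ (r : ℝ) (_ : 0 < r),
    ENNReal.ofReal (r ^ (κ - n)) * ∫⁻ y in Metric.ball x r, ENNReal.ofReal |f y|

/-- The Riesz potential of order `1`: `I₁ f (x) = ∫_{ℝⁿ} |f y| / |x-y|^{n-1} dy`. -/
noncomputable def rieszPot (n : ℕ) (f : EuclideanSpace ℝ (Fin n) → ℝ)
    (x : EuclideanSpace ℝ (Fin n)) : ℝ≥0∞ :=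
  ∫⁻ y, ENNReal.ofReal |f y| / edist x y ^ ((n : ℝ) - 1)

/-- `Ω` is an `(α, β)`-John domain with John center `x₀`: every `x ∈ Ω` can be joined to `x₀`
by a rectifiable curve `γ : [0, L] → Ω` parametrized by arclength (hence `1`-Lipschitz) with
`γ 0 = x`, `γ L = x₀`, `L ≤ β` and `dist (γ t, ∂Ω) ≥ (α/β) t`. -/
def IsJohnDomainWithCenter (n : ℕ) (α β : ℝ) (Ω : Set (EuclideanSpace ℝ (Fin n)))
    (x₀ : EuclideanSpace ℝ (Fin n)) : Prop :=
  x₀ ∈ Ω ∧ ∀ x ∈ Ω, ∃ L : ℝ, 0 ≤ L ∧ L ≤ β ∧ ∃ γ : ℝ → EuclideanSpace ℝ (Fin n),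
    γ 0 = x ∧ γ L = x₀ ∧ (∀ t ∈ Set.Icc 0 L, γ t ∈ Ω) ∧
    LipschitzOnWith 1 γ (Set.Icc 0 L) ∧
    ∀ t ∈ Set.Icc 0 L, α / β * t ≤ Metric.infDist (γ t) (frontier Ω)

/-- `Ω` is an `(α, β)`-John domain. -/
def IsJohnDomain (n : ℕ) (α β : ℝ) (Ω : Set (EuclideanSpace ℝ (Fin n))) : Prop :=
  ∃ x₀, IsJohnDomainWithCenter n α β Ω x₀

/-- Countable subadditivity of `x ↦ x ^ θ` for `θ ∈ (0, 1]`. -/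
theorem rpow_tsum_le_tsum_rpow {ι : Type*} {θ : ℝ} (h0 : 0 < θ) (h1 : θ ≤ 1) (a : ι → ℝ≥0∞) :
    (∑' i, a i) ^ θ ≤ ∑' i, a i ^ θ := by
  have hfin : ∀ s : Finset ι, (∑ i ∈ s, a i) ^ θ ≤ ∑ i ∈ s, a i ^ θ := by
    classical
    intro s
    induction s using Finset.induction_on with
    | empty => simp [h0]
    | insert i s hi ih =>
      rw [Finset.sum_insert hi, Finset.sum_insert hi]
      exact (ENNReal.rpow_add_le_add_rpow _ _ h0.le h1).trans (by gcongr)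
  rw [← ENNReal.le_rpow_inv_iff h0, ENNReal.tsum_eq_iSup_sum]
  refine iSup_le fun s => ?_
  rw [ENNReal.le_rpow_inv_iff h0]
  exact (hfin s).trans (ENNReal.sum_le_tsum s)

/-- For a family `a : ℤ → [0, ∞]` with vanishing tails and total sum larger than `t > 0`, some
index `k` is the one at which the sum from above crosses the level `t`. -/
theorem exists_tail_le_lt (a : ℤ → ℝ≥0∞) (ha : ∑' i : ℕ, a i ≠ ∞) {t : ℝ≥0∞} (ht : 0 < t)
    (hlt : t < ∑' k, a k) :
    ∃ k : ℤ, ∑' i : ℕ, a (k + 1 + i) ≤ t ∧ t < (∑' i : ℕ, a (k + 1 + i)) + a k := by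
  have hstep : ∀ k : ℤ, ∑' i : ℕ, a (k + i) = (∑' i : ℕ, a (k + 1 + i)) + a k := by
    intro k
    rw [tsum_eq_zero_add' (f := fun i : ℕ => a (k + i)) ENNReal.summable, add_comm]
    simp only [Nat.cast_add, Nat.cast_one, Nat.cast_zero, add_zero]
    refine congrArg (· + a k) (tsum_congr fun i => congrArg a ?_)
    ring
  have hmono : ∀ k m : ℤ, k ≤ m → ∑' i : ℕ, a (m + i) ≤ ∑' i : ℕ, a (k + i) := by
    intro k m hkm
    obtain ⟨d, rfl⟩ := Int.le.dest hkm
    have : Function.Injective (fun i : ℕ => d + i) := add_right_injective d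
    refine le_trans (le_of_eq ?_)
      (ENNReal.tsum_comp_le_tsum_of_injective this fun i : ℕ => a (k + i))
    refine tsum_congr fun i => congrArg a ?_
    push_cast; ring
  have hlow : ∃ k : ℤ, t < ∑' i : ℕ, a (k + i) := by
    rw [ENNReal.tsum_eq_iSup_sum, lt_iSup_iff] at hlt
    obtain ⟨s, hs⟩ := hlt
    obtain ⟨b, hb⟩ := s.bddBelow
    refine ⟨b, hs.trans_le ?_⟩
    have hsub : (s : Set ℤ) ⊆ Set.range (fun i : ℕ => b + (i : ℤ)) := by
      intro j hj
      obtain ⟨d, hd⟩ := Int.le.dest (hb hj)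
      exact ⟨d, hd⟩
    have hinj : Function.Injective (fun i : ℕ => b + (i : ℤ)) := fun i j h => by simpa using h
    classical
    calc ∑ j ∈ s, a j = ∑ j ∈ (s.preimage _ hinj.injOn).image (fun i : ℕ => b + (i : ℤ)), a j := by
          rw [Finset.image_preimage_of_bij]
          exact ⟨fun x hx => hx, hinj.injOn, fun x hx => by
            obtain ⟨i, hi⟩ := hsub hx
            exact ⟨i, by simpa [hi] using hx, hi⟩⟩
      _ = ∑ i ∈ s.preimage _ hinj.injOn, a (b + i) := Finset.sum_image hinj.injOn
      _ ≤ _ := ENNReal.sum_le_tsum _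
  have hhigh : ∃ N : ℕ, ∑' i : ℕ, a ((N : ℤ) + i) ≤ t := by
    have := ENNReal.tendsto_sum_nat_add (fun i : ℕ => a i) ha
    obtain ⟨N, hN⟩ := (this.eventually_lt_const ht).exists
    refine ⟨N, le_trans (le_of_eq ?_) hN.le⟩
    refine tsum_congr fun i => congrArg a ?_
    push_cast; ring
  obtain ⟨N, hN⟩ := hhigh
  obtain ⟨k, hk, hmax⟩ := Int.exists_greatest_of_bdd
    (P := fun k : ℤ => t < ∑' i : ℕ, a (k + i))
    ⟨N, fun z hz => by
      by_contra! h
      exact absurd ((hmono _ _ h.le).trans hN) (not_le.2 hz)⟩ hlow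
  refine ⟨k, ?_, by rw [← hstep]; exact hk⟩
  by_contra! h
  exact absurd (hmax _ h) (by omega)

theorem hContent_le_tsum {n : ℕ} {δ : ℝ} {ι : Type*} [Countable ι] [Infinite ι]
    {S : Set (EuclideanSpace ℝ (Fin n))} (x : ι → EuclideanSpace ℝ (Fin n)) (r : ι → ℝ≥0)
    (h : S ⊆ ⋃ i, Metric.ball (x i) (r i)) : hContent n δ S ≤ ∑' i, (r i : ℝ≥0∞) ^ δ := by
  obtain ⟨e⟩ : Nonempty (ℕ ≃ ι) := nonempty_equiv_of_countable
  rw [← e.tsum_eq]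
  refine (iInf_le _ (x ∘ e)).trans ((iInf_le _ (r ∘ e)).trans (iInf_le _ ?_))
  refine h.trans fun y hy => ?_
  obtain ⟨i, hi⟩ := mem_iUnion.1 hy
  exact mem_iUnion.2 ⟨e.symm i, by simpa using hi⟩

theorem hContent_mono {n : ℕ} {δ : ℝ} {S T : Set (EuclideanSpace ℝ (Fin n))} (h : S ⊆ T) :
    hContent n δ S ≤ hContent n δ T :=
  iInf_mono fun _ => iInf_mono fun _ => iInf_mono' fun hT => ⟨h.trans hT, le_rfl⟩

/-- The index of the half-open dyadic cube of side length `2 ^ k` containing `x`. -/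
noncomputable def dyadicIndex {n : ℕ} (k : ℤ) (x : EuclideanSpace ℝ (Fin n)) : Fin n → ℤ :=
  fun c => ⌊x c / (2 : ℝ) ^ k⌋

theorem dyadicIndex_add {n : ℕ} (k : ℤ) (i : ℕ) (x : EuclideanSpace ℝ (Fin n)) :
    dyadicIndex (k + i) x = fun c => dyadicIndex k x c / ((2 ^ i : ℕ) : ℤ) := by
  funext c
  rw [dyadicIndex, dyadicIndex, ← Int.floor_div_natCast, zpow_add₀ two_ne_zero, ← div_div]
  simp

theorem dist_corner_lt {n : ℕ} (k : ℤ) (x : EuclideanSpace ℝ (Fin n)) :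
    dist x (WithLp.toLp 2 fun c => (dyadicIndex k x c : ℝ) * 2 ^ k) < (n + 1) * (2 : ℝ) ^ k := by
  have h2 : (0 : ℝ) < 2 ^ k := by positivity
  rw [EuclideanSpace.dist_eq]
  refine (Real.sqrt_le_sqrt (y := (n * 2 ^ k) ^ 2) ?_).trans_lt ?_
  · calc _ ≤ ∑ _c : Fin n, ((2 : ℝ) ^ k) ^ 2 := by
          refine Finset.sum_le_sum fun c _ => ?_
          have h1 := Int.floor_le (x c / (2 : ℝ) ^ k)
          have h3 := Int.lt_floor_add_one (x c / (2 : ℝ) ^ k)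
          rw [le_div_iff₀ h2] at h1
          rw [div_lt_iff₀ h2] at h3
          rw [Real.dist_eq]
          gcongr
          simp only [dyadicIndex]
          rw [abs_le]
          constructor <;> nlinarith
      _ ≤ _ := by
          simp only [Finset.sum_const, Finset.card_univ, Fintype.card_fin, nsmul_eq_mul, mul_pow]
          gcongr
          exact_mod_cast Nat.le_self_pow two_ne_zero n
  · rw [Real.sqrt_sq (by positivity)]
    nlinarith

/-- The dyadic neighbours of `z` at scale `k`: a ball of radius `2 ^ k` around `z` only meets
cubes with index in this set. -/
noncomputable def dyadicNhd {n : ℕ} (k : ℤ) (z : EuclideanSpace ℝ (Fin n)) :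
    Finset (Fin n → ℤ) :=
  Finset.Icc (fun c => dyadicIndex k z c - 1) (fun c => dyadicIndex k z c + 1)

theorem card_dyadicNhd {n : ℕ} (k : ℤ) (z : EuclideanSpace ℝ (Fin n)) :
    (dyadicNhd k z).card = 3 ^ n := by
  rw [dyadicNhd, Pi.card_Icc]
  simp [show ∀ a : ℤ, a + 1 + 1 - (a - 1) = 3 by intro a; ring]

theorem mem_dyadicNhd {n : ℕ} {k : ℤ} {x z : EuclideanSpace ℝ (Fin n)}
    (h : dist x z < (2 : ℝ) ^ k) : dyadicIndex k x ∈ dyadicNhd k z := by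
  have h2 : (0 : ℝ) < 2 ^ k := by positivity
  have hc : ∀ c, |x c / (2 : ℝ) ^ k - z c / (2 : ℝ) ^ k| < 1 := by
    intro c
    rw [← sub_div, abs_div, abs_of_pos h2, div_lt_one h2]
    refine lt_of_le_of_lt ?_ h
    rw [dist_eq_norm]
    simpa using PiLp.norm_apply_le (x - z) c
  rw [dyadicNhd, Finset.mem_Icc, Pi.le_def, Pi.le_def]
  refine ⟨fun c => ?_, fun c => ?_⟩ <;> simp only [dyadicIndex] <;> have := abs_lt.1 (hc c)
  · rw [Int.le_floor]
    have := Int.floor_le (z c / (2 : ℝ) ^ k)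
    push_cast; linarith
  · rw [← Int.lt_add_one_iff, Int.floor_lt]
    have := Int.lt_floor_add_one (z c / (2 : ℝ) ^ k)
    push_cast; linarith

theorem measurableSet_slab (s w : ℝ≥0∞) :
    MeasurableSet {t : ℝ | s ≤ ENNReal.ofReal t ∧ ENNReal.ofReal t < s + w} :=
  (measurableSet_le measurable_const ENNReal.measurable_ofReal).inter
    (measurableSet_lt ENNReal.measurable_ofReal measurable_const)

theorem volume_slab_le (s w : ℝ≥0∞) :
    volume ({t : ℝ | s ≤ ENNReal.ofReal t ∧ ENNReal.ofReal t < s + w} ∩ Ioi 0) ≤ w := by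
  rcases eq_or_ne w ∞ with rfl | hw
  · exact le_top
  rcases eq_or_ne s ∞ with rfl | hs
  · simp
  calc _ ≤ volume (Ico s.toReal (s + w).toReal) := by
        refine measure_mono fun t ⟨⟨h1, h2⟩, h3⟩ => ⟨?_, ?_⟩
        · rwa [← ENNReal.le_ofReal_iff_toReal_le hs (le_of_lt h3)]
        · rwa [← ENNReal.ofReal_lt_iff_lt_toReal (le_of_lt h3) (ENNReal.add_ne_top.2 ⟨hs, hw⟩)]
    _ = w := by
        rw [Real.volume_Ico, ENNReal.toReal_add hs hw, add_sub_cancel_left, ENNReal.ofReal_toReal hw]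

/-- The layer-cake bound for weighted sums of indicators of dyadic cubes. -/
theorem lintegral_hContent_dyadic_le {n : ℕ} (hn : n ≠ 0) {δ : ℝ} (hδ : 0 < δ)
    (w : ℤ → (Fin n → ℤ) → ℝ≥0∞) :
    ∫⁻ t in Ioi (0 : ℝ),
        hContent n δ {x | ENNReal.ofReal t < ∑' k, w k (dyadicIndex k x)} ≤
      ((n : ℝ≥0∞) + 1) ^ δ * ∑' Q : ℤ × (Fin n → ℤ), w Q.1 Q.2 * 2 ^ ((Q.1 : ℝ) * δ) := by
  have : NeZero n := ⟨hn⟩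
  by_cases hfin : ∑' Q : ℤ × (Fin n → ℤ), w Q.1 Q.2 * 2 ^ ((Q.1 : ℝ) * δ) = ∞
  · rw [hfin, ENNReal.mul_top]
    · exact le_top
    · exact (ENNReal.rpow_pos (zero_lt_one.trans_le le_add_self) (by simp)).ne'
  have htail : ∀ x : EuclideanSpace ℝ (Fin n),
      ∑' i : ℕ, w i (dyadicIndex i x) ≠ ∞ := by
    intro x hx
    refine hfin (top_le_iff.1 ?_)
    have hinj : Function.Injective
        (fun i : ℕ => ((i : ℤ), dyadicIndex (i : ℤ) x)) := fun i j h => by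
      simpa using congrArg Prod.fst h
    refine le_trans ?_ (ENNReal.tsum_comp_le_tsum_of_injective hinj _)
    rw [← hx]
    refine ENNReal.tsum_le_tsum fun i => le_mul_of_one_le_right' ?_
    rw [← ENNReal.rpow_zero (x := 2)]
    exact ENNReal.rpow_le_rpow_of_exponent_le (by norm_num) (by positivity)
  let s : ℤ × (Fin n → ℤ) → ℝ≥0∞ := fun Q =>
    ∑' i : ℕ, w (Q.1 + 1 + i) (fun c => Q.2 c / ((2 ^ (i + 1) : ℕ) : ℤ))
  let V : ℤ × (Fin n → ℤ) → Set ℝ := fun Q =>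
    {t : ℝ | s Q ≤ ENNReal.ofReal t ∧ ENNReal.ofReal t < s Q + w Q.1 Q.2}
  let R : ℤ × (Fin n → ℤ) → ℝ≥0 := fun Q => (n + 1) * 2 ^ Q.1
  have hR : ∀ Q, (R Q : ℝ≥0∞) ^ δ = ((n : ℝ≥0∞) + 1) ^ δ * 2 ^ ((Q.1 : ℝ) * δ) := by
    intro Q
    have : (R Q : ℝ≥0∞) = ((n : ℝ≥0∞) + 1) * 2 ^ (Q.1 : ℝ) := by
      simp only [R]
      rw [ENNReal.rpow_intCast, ENNReal.coe_mul, ENNReal.coe_zpow two_ne_zero]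
      simp
    rw [this, ENNReal.mul_rpow_of_nonneg _ _ hδ.le, ENNReal.rpow_mul]
  have hpt : ∀ t ∈ Ioi (0 : ℝ),
      hContent n δ {x | ENNReal.ofReal t < ∑' k, w k (dyadicIndex k x)} ≤
        ∑' Q, (V Q).indicator (fun _ => (R Q : ℝ≥0∞) ^ δ) t := by
    intro t ht
    classical
    have h0 : ∀ Q, (V Q).indicator (fun _ => (R Q : ℝ≥0∞) ^ δ) t =
        ((if t ∈ V Q then R Q else 0 : ℝ≥0) : ℝ≥0∞) ^ δ := by
      intro Q
      by_cases h : t ∈ V Q <;> simp [h, hδ]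
    simp_rw [h0]
    refine hContent_le_tsum (fun Q => WithLp.toLp 2 fun c => (Q.2 c : ℝ) * 2 ^ Q.1) _ ?_
    intro x hx
    obtain ⟨k, hk1, hk2⟩ := exists_tail_le_lt (fun k => w k (dyadicIndex k x)) (htail x)
      (ENNReal.ofReal_pos.2 ht) hx
    refine mem_iUnion.2 ⟨(k, dyadicIndex k x), ?_⟩
    have hs : s (k, dyadicIndex k x) =
        ∑' i : ℕ, w (k + 1 + i) (dyadicIndex (k + 1 + i) x) := by
      refine tsum_congr fun i => ?_
      have := dyadicIndex_add k (i + 1) x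
      rw [← this]
      congr 2
      push_cast; ring
    have hV : t ∈ V (k, dyadicIndex k x) := by
      simp only [V, mem_ofPred_eq, hs]
      exact ⟨hk1, hk2⟩
    rw [if_pos hV, Metric.mem_ball]
    simpa [R] using dist_corner_lt k x
  calc _ ≤ ∫⁻ t in Ioi (0 : ℝ), ∑' Q, (V Q).indicator (fun _ => (R Q : ℝ≥0∞) ^ δ) t :=
        setLIntegral_mono' measurableSet_Ioi hpt
    _ = ∑' Q, ∫⁻ t in Ioi (0 : ℝ), (V Q).indicator (fun _ => (R Q : ℝ≥0∞) ^ δ) t :=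
        lintegral_tsum fun Q =>
          (measurable_const.indicator (measurableSet_slab _ _)).aemeasurable
    _ ≤ ∑' Q : ℤ × (Fin n → ℤ), ((n : ℝ≥0∞) + 1) ^ δ * (w Q.1 Q.2 * 2 ^ ((Q.1 : ℝ) * δ)) := by
        refine ENNReal.tsum_le_tsum fun Q => ?_
        rw [lintegral_indicator_const (measurableSet_slab _ _),
          Measure.restrict_apply (measurableSet_slab _ _), hR]
        calc _ ≤ ((n : ℝ≥0∞) + 1) ^ δ * 2 ^ ((Q.1 : ℝ) * δ) * w Q.1 Q.2 := by
              gcongr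
              exact volume_slab_le _ _
          _ = _ := by ring
    _ = _ := ENNReal.tsum_mul_left

/-- The geometric kernel controlling the maximal function of a ball. -/
noncomputable def geomKernel (α : ℝ) (j : ℤ) : ℝ≥0∞ :=
  if 0 ≤ j then 2 ^ (-((j : ℝ) * α)) else 0

theorem tsum_geomKernel_ne_top {α δ : ℝ} (h : δ < α) :
    ∑' j : ℤ, geomKernel α j * 2 ^ ((j : ℝ) * δ) ≠ ∞ := by
  have hinj : Function.Injective (fun i : ℕ => (i : ℤ)) := Nat.cast_injective
  rw [← hinj.tsum_eq]
  · have : ∀ i : ℕ, geomKernel α i * 2 ^ (((i : ℤ) : ℝ) * δ) =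
        ((2 : ℝ≥0∞) ^ (δ - α)) ^ i := by
      intro i
      rw [geomKernel, if_pos (by positivity), ← ENNReal.rpow_add _ _ (by norm_num) (by norm_num),
        ← ENNReal.rpow_natCast, ← ENNReal.rpow_mul]
      congr 1
      push_cast; ring
    simp_rw [this]
    refine (tsum_geometric_lt_top.2 ?_).ne
    exact ENNReal.rpow_lt_one_of_one_lt_of_neg (by norm_num) (by linarith)
  · intro j hj
    by_contra hn
    refine hj ?_
    have : ¬ 0 ≤ j := fun h0 => hn ⟨j.toNat, by simpa using h0⟩
    simp [geomKernel, this]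

theorem tsum_dyadicNhd_geomKernel {n : ℕ} (α δ : ℝ) (l : ℤ) (z : EuclideanSpace ℝ (Fin n)) :
    ∑' Q : ℤ × (Fin n → ℤ), geomKernel α (Q.1 - l) *
        (dyadicNhd Q.1 z : Set (Fin n → ℤ)).indicator 1 Q.2 * 2 ^ ((Q.1 : ℝ) * δ) =
      3 ^ n * (∑' j : ℤ, geomKernel α j * 2 ^ ((j : ℝ) * δ)) * 2 ^ ((l : ℝ) * δ) := by
  rw [ENNReal.tsum_prod (f := fun k m => geomKernel α (k - l) *
        (dyadicNhd k z : Set (Fin n → ℤ)).indicator 1 m * 2 ^ ((k : ℝ) * δ)),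
    ← (Equiv.addRight l).tsum_eq, ← ENNReal.tsum_mul_left, ← ENNReal.tsum_mul_right]
  refine tsum_congr fun j => ?_
  have hcard : ∑' m : Fin n → ℤ,
      (dyadicNhd (j + l) z : Set (Fin n → ℤ)).indicator (1 : (Fin n → ℤ) → ℝ≥0∞) m = 3 ^ n := by
    rw [← tsum_subtype]
    simp [card_dyadicNhd]
  simp only [Equiv.coe_addRight, add_sub_cancel_right]
  rw [ENNReal.tsum_mul_right, ENNReal.tsum_mul_left, hcard, Int.cast_add, add_mul,
    ENNReal.rpow_add _ _ (by norm_num) (by norm_num)]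
  ring

theorem four_pow_mul_two_rpow (n : ℕ) (j l : ℤ) :
    (4 : ℝ≥0∞) ^ n * 2 ^ (-(((j + 2 - l : ℤ) : ℝ) * n)) =
      ENNReal.ofReal (((2 : ℝ) ^ l / 2 ^ j) ^ n) := by
  have h4 : (4 : ℝ≥0∞) ^ n = ENNReal.ofReal (4 ^ n) := by
    rw [ENNReal.ofReal_pow (by norm_num)]; norm_num
  have h2 : ∀ y : ℝ, (2 : ℝ≥0∞) ^ y = ENNReal.ofReal (2 ^ y) := by
    intro y
    rw [← ENNReal.ofReal_rpow_of_pos (by norm_num)]; norm_num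
  rw [h4, h2, ← ENNReal.ofReal_mul (by positivity), ← zpow_sub₀ two_ne_zero]
  congr 1
  have h42 : (4 : ℝ) = 2 ^ (2 : ℝ) := by norm_num
  rw [h42, ← Real.rpow_intCast, ← Real.rpow_natCast, ← Real.rpow_natCast,
    ← Real.rpow_mul (by norm_num), ← Real.rpow_mul (by norm_num), ← Real.rpow_add (by norm_num)]
  congr 1
  push_cast; ring

/-- The density of a ball in any ball centred at `x` is controlled by the geometric kernel. -/
theorem density_ball_rpow_le {n : ℕ} {θ : ℝ} (hθ : 0 < θ) (x z : EuclideanSpace ℝ (Fin n))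
    (l : ℤ) {r : ℝ} (hr : 0 < r) :
    (ENNReal.ofReal (r ^ ((0 : ℝ) - n)) *
        volume (Metric.ball x r ∩ Metric.ball z ((2 : ℝ) ^ l))) ^ θ ≤
      (volume (Metric.ball (0 : EuclideanSpace ℝ (Fin n)) 1) * 4 ^ n) ^ θ *
        ∑' k : ℤ, geomKernel (n * θ) (k - l) *
          (dyadicNhd k z : Set (Fin n → ℤ)).indicator 1 (dyadicIndex k x) := by
  rcases (Metric.ball x r ∩ Metric.ball z ((2 : ℝ) ^ l)).eq_empty_or_nonempty with he | ⟨y, hy1, hy2⟩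
  · simp [he, hθ]
  have hl : (0 : ℝ) < 2 ^ l := by positivity
  obtain ⟨j, hj1, hj2⟩ := exists_mem_Ico_zpow (lt_max_of_lt_left hr : 0 < max r ((2 : ℝ) ^ l))
    one_lt_two
  have hj : (0 : ℝ) < 2 ^ j := by positivity
  have hlj : l < j + 1 := (zpow_lt_zpow_iff_right₀ one_lt_two).1 ((le_max_right _ _).trans_lt hj2)
  have hdist : dist x z < (2 : ℝ) ^ (j + 2) := by
    have h1 : dist x z ≤ dist y x + dist y z := by
      rw [dist_comm y x]; exact dist_triangle _ _ _
    have h2 : (2 : ℝ) ^ (j + 2) = 2 * 2 ^ (j + 1) := by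
      rw [← zpow_one_add₀ two_ne_zero]; congr 1; ring
    have := le_max_left r ((2 : ℝ) ^ l)
    have := le_max_right r ((2 : ℝ) ^ l)
    have := Metric.mem_ball.1 hy1
    have := Metric.mem_ball.1 hy2
    linarith
  have hrn : r ^ ((0 : ℝ) - n) = (r ^ n)⁻¹ := by
    rw [zero_sub, Real.rpow_neg hr.le, Real.rpow_natCast]
  have hvol : ∀ (v : EuclideanSpace ℝ (Fin n)) {ρ : ℝ}, 0 < ρ → volume (Metric.ball v ρ) =
      ENNReal.ofReal (ρ ^ n) * volume (Metric.ball (0 : EuclideanSpace ℝ (Fin n)) 1) := by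
    intro v ρ hρ
    rw [Measure.addHaar_ball_of_pos _ _ hρ, finrank_euclideanSpace_fin]
  have key : ∃ ρ : ℝ, 0 < ρ ∧ (r ^ n)⁻¹ * ρ ^ n ≤ ((2 : ℝ) ^ l / 2 ^ j) ^ n ∧
      volume (Metric.ball x r ∩ Metric.ball z ((2 : ℝ) ^ l)) ≤
        ENNReal.ofReal (ρ ^ n) * volume (Metric.ball (0 : EuclideanSpace ℝ (Fin n)) 1) := by
    rcases le_total r ((2 : ℝ) ^ l) with h | h
    · refine ⟨r, hr, ?_, (measure_mono inter_subset_left).trans_eq (hvol _ hr)⟩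
      rw [inv_mul_cancel₀ (by positivity)]
      rw [max_eq_right h] at hj1
      exact one_le_pow₀ ((one_le_div hj).2 hj1)
    · refine ⟨2 ^ l, hl, ?_, (measure_mono inter_subset_right).trans_eq (hvol _ hl)⟩
      rw [max_eq_left h] at hj1
      rw [div_pow, inv_mul_eq_div]
      gcongr
  obtain ⟨ρ, hρ, hρ1, hρ2⟩ := key
  calc _ ≤ (volume (Metric.ball (0 : EuclideanSpace ℝ (Fin n)) 1) *
        (4 ^ n * 2 ^ (-(((j + 2 - l : ℤ) : ℝ) * n)))) ^ θ := by
        refine ENNReal.rpow_le_rpow ?_ hθ.le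
        rw [four_pow_mul_two_rpow, hrn]
        calc _ ≤ ENNReal.ofReal (r ^ n)⁻¹ * (ENNReal.ofReal (ρ ^ n) *
              volume (Metric.ball (0 : EuclideanSpace ℝ (Fin n)) 1)) := by gcongr
          _ = volume (Metric.ball (0 : EuclideanSpace ℝ (Fin n)) 1) *
              ENNReal.ofReal ((r ^ n)⁻¹ * ρ ^ n) := by
            rw [ENNReal.ofReal_mul (by positivity)]; ring
          _ ≤ _ := by gcongr
    _ = (volume (Metric.ball (0 : EuclideanSpace ℝ (Fin n)) 1) * 4 ^ n) ^ θ *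
        (geomKernel (n * θ) (j + 2 - l) *
          (dyadicNhd (j + 2) z : Set (Fin n → ℤ)).indicator 1 (dyadicIndex (j + 2) x)) := by
        rw [indicator_of_mem (Finset.mem_coe.2 (mem_dyadicNhd hdist)), geomKernel,
          if_pos (by omega), ← mul_assoc, ENNReal.mul_rpow_of_nonneg _ _ hθ.le, ← ENNReal.rpow_mul]
        simp only [Pi.one_apply, mul_one]
        congr 2
        ring
    _ ≤ _ := by
        gcongr
        exact ENNReal.le_tsum (f := fun k : ℤ => geomKernel (n * θ) (k - l) *
          (dyadicNhd k z : Set (Fin n → ℤ)).indicator 1 (dyadicIndex k x)) (j + 2)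

theorem lintegral_rpow_le_measure_mul {α : Type*} [MeasurableSpace α] {μ : Measure α} {s : ℝ}
    (hs : 1 ≤ s) {g : α → ℝ≥0∞} (hg : AEMeasurable g μ) :
    (∫⁻ y, g y ∂μ) ^ s ≤ μ univ ^ (s - 1) * ∫⁻ y, g y ^ s ∂μ := by
  have hs0 : 0 < s := by linarith
  have h := eLpNorm'_le_eLpNorm'_mul_rpow_measure_univ (μ := μ) one_pos hs
    hg.aestronglyMeasurable
  simp only [eLpNorm', enorm_eq_self, ENNReal.rpow_one, div_one] at h
  calc _ ≤ ((∫⁻ y, g y ^ s ∂μ) ^ (1 / s) * μ univ ^ (1 - 1 / s)) ^ s := by gcongr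
    _ = _ := by
      rw [ENNReal.mul_rpow_of_nonneg _ _ hs0.le, ← ENNReal.rpow_mul, ← ENNReal.rpow_mul,
        one_div_mul_cancel hs0.ne', ENNReal.rpow_one, sub_mul, one_div_mul_cancel hs0.ne', one_mul,
        mul_comm]

theorem average_rpow_le {n : ℕ} {s θ : ℝ} (hs : 1 ≤ s) (hθ : 0 < θ) (hθ1 : θ ≤ 1)
    {g : EuclideanSpace ℝ (Fin n) → ℝ≥0∞} (hg : AEMeasurable g) {ι : Type*} [Countable ι]
    (β : ι → ℝ≥0∞) (z : ι → EuclideanSpace ℝ (Fin n)) (l : ι → ℤ)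
    (hcov : ∀ y, g y ^ s ≤ ∑' i, β i * (Metric.ball (z i) ((2 : ℝ) ^ l i)).indicator 1 y)
    (x : EuclideanSpace ℝ (Fin n)) {r : ℝ} (hr : 0 < r) :
    (ENNReal.ofReal (r ^ ((0 : ℝ) - n)) * ∫⁻ y in Metric.ball x r, g y) ^ (s * θ) ≤
      (volume (Metric.ball (0 : EuclideanSpace ℝ (Fin n)) 1) ^ (s - 1)) ^ θ *
      (volume (Metric.ball (0 : EuclideanSpace ℝ (Fin n)) 1) * 4 ^ n) ^ θ *
        ∑' i, β i ^ θ * ∑' k : ℤ, geomKernel (n * θ) (k - l i) *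
          (dyadicNhd k (z i) : Set (Fin n → ℤ)).indicator 1 (dyadicIndex k x) := by
  set v := volume (Metric.ball (0 : EuclideanSpace ℝ (Fin n)) 1) with hv
  set q := ENNReal.ofReal (r ^ ((0 : ℝ) - n)) with hq
  have hq0 : q ≠ 0 := (ENNReal.ofReal_pos.2 (by positivity)).ne'
  have hqt : q ≠ ∞ := ENNReal.ofReal_ne_top
  have hball : volume (Metric.ball x r) = q⁻¹ * v := by
    rw [Measure.addHaar_ball_of_pos _ _ hr, finrank_euclideanSpace_fin, hq,
      ← ENNReal.ofReal_inv_of_pos (by positivity), zero_sub, Real.rpow_neg hr.le, inv_inv,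
      Real.rpow_natCast]
  have hs0 : 0 ≤ s - 1 := by linarith
  have hjensen : (q * ∫⁻ y in Metric.ball x r, g y) ^ s ≤
      v ^ (s - 1) * (q * ∫⁻ y in Metric.ball x r, g y ^ s) := by
    rw [ENNReal.mul_rpow_of_nonneg _ _ (by linarith)]
    calc _ ≤ q ^ s * ((q⁻¹ * v) ^ (s - 1) * ∫⁻ y in Metric.ball x r, g y ^ s) := by
          gcongr
          refine (lintegral_rpow_le_measure_mul hs hg.restrict).trans_eq ?_
          rw [Measure.restrict_apply_univ, hball]
      _ = (q ^ s * q⁻¹ ^ (s - 1)) * (v ^ (s - 1) * ∫⁻ y in Metric.ball x r, g y ^ s) := by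
          rw [ENNReal.mul_rpow_of_nonneg _ _ hs0]; ring
      _ = _ := by
          rw [ENNReal.inv_rpow, ← ENNReal.rpow_neg, ← ENNReal.rpow_add _ _ hq0 hqt]
          simp only [neg_sub, add_sub_cancel, ENNReal.rpow_one]
          ring
  have hint : q * ∫⁻ y in Metric.ball x r, g y ^ s ≤
      ∑' i, β i * (q * volume (Metric.ball x r ∩ Metric.ball (z i) ((2 : ℝ) ^ l i))) := by
    calc _ ≤ q * ∫⁻ y in Metric.ball x r,
          ∑' i, β i * (Metric.ball (z i) ((2 : ℝ) ^ l i)).indicator 1 y := by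
          gcongr with y
          exact hcov y
      _ = _ := by
          rw [lintegral_tsum fun i =>
            ((measurable_one.indicator measurableSet_ball).const_mul _).aemeasurable,
            ← ENNReal.tsum_mul_left]
          refine tsum_congr fun i => ?_
          rw [lintegral_const_mul _ (measurable_one.indicator measurableSet_ball),
            lintegral_indicator_one measurableSet_ball, Measure.restrict_apply measurableSet_ball,
            inter_comm]
          ring
  calc _ = ((q * ∫⁻ y in Metric.ball x r, g y) ^ s) ^ θ := ENNReal.rpow_mul _ _ _
    _ ≤ (v ^ (s - 1) * ∑' i, β i *
          (q * volume (Metric.ball x r ∩ Metric.ball (z i) ((2 : ℝ) ^ l i)))) ^ θ := by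
        gcongr
        exact hjensen.trans (by gcongr)
    _ ≤ (v ^ (s - 1)) ^ θ * ∑' i, (β i *
          (q * volume (Metric.ball x r ∩ Metric.ball (z i) ((2 : ℝ) ^ l i)))) ^ θ := by
        rw [ENNReal.mul_rpow_of_nonneg _ _ hθ.le]
        gcongr
        exact rpow_tsum_le_tsum_rpow hθ hθ1 _
    _ ≤ _ := by
        rw [mul_assoc]
        gcongr
        rw [← ENNReal.tsum_mul_left]
        refine ENNReal.tsum_le_tsum fun i => ?_
        rw [ENNReal.mul_rpow_of_nonneg _ _ hθ.le, mul_left_comm]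
        gcongr
        exact density_ball_rpow_le hθ x (z i) (l i) hr

/-- Dyadic level sets are controlled by the Choquet integral. -/
theorem tsum_hContent_superlevel_le (n : ℕ) (δ : ℝ) (u : EuclideanSpace ℝ (Fin n) → ℝ) :
    ∑' k : ℤ, (2 : ℝ≥0∞) ^ (k : ℝ) * hContent n δ {x | (2 : ℝ) ^ k < u x} ≤
      2 * choquet n δ univ u := by
  have hmono : Monotone fun k : ℤ => (2 : ℝ) ^ k := zpow_right_mono₀ one_le_two
  have hdisj := hmono.pairwise_disjoint_on_Ioc_pred
  have h2 : ∀ k : ℤ, (2 : ℝ≥0∞) ^ (k : ℝ) = 2 * volume (Ioc ((2 : ℝ) ^ (Order.pred k)) (2 ^ k)) := by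
    intro k
    have hk : (2 : ℝ) ^ k - 2 ^ (k - 1) = 2 ^ (k - 1) := by
      rw [zpow_sub_one₀ two_ne_zero]; ring
    have h3 : (2 : ℝ≥0∞) = ENNReal.ofReal 2 := by norm_num
    rw [Real.volume_Ioc, Order.pred_eq_sub_one, hk, h3, ENNReal.ofReal_rpow_of_pos two_pos,
      ← ENNReal.ofReal_mul two_pos.le, Real.rpow_intCast, zpow_sub_one₀ two_ne_zero]
    congr 1
    ring
  calc _ = 2 * ∑' k : ℤ, volume (Ioc ((2 : ℝ) ^ (Order.pred k)) (2 ^ k)) *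
        hContent n δ {x | (2 : ℝ) ^ k < u x} := by
        rw [← ENNReal.tsum_mul_left]
        simp_rw [h2, mul_assoc]
    _ ≤ 2 * ∑' k : ℤ, ∫⁻ t in Ioc ((2 : ℝ) ^ (Order.pred k)) (2 ^ k),
        hContent n δ {x ∈ univ | t < u x} := by
        gcongr with k
        rw [mul_comm, ← setLIntegral_const]
        exact setLIntegral_mono' measurableSet_Ioc fun t ht =>
          hContent_mono fun x hx => ⟨mem_univ x, ht.2.trans_lt hx⟩
    _ = 2 * ∫⁻ t in ⋃ k : ℤ, Ioc ((2 : ℝ) ^ (Order.pred k)) (2 ^ k),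
        hContent n δ {x ∈ univ | t < u x} := by
        rw [lintegral_iUnion (fun _ => measurableSet_Ioc) hdisj]
    _ ≤ _ := by
        rw [choquet]
        gcongr
        exact iUnion_subset fun k t ht => lt_trans (by positivity) ht.1

/-- A function with finite Choquet integral is dominated by a combination of indicators of balls
with dyadic radii whose total weight is controlled by the integral. -/
theorem exists_ball_majorant {n : ℕ} {δ θ : ℝ} (hδ : 0 < δ) (hθ : 0 < θ)
    {u : EuclideanSpace ℝ (Fin n) → ℝ} (hu : choquet n δ univ u ≠ ∞) {ε : ℝ≥0∞} (hε : ε ≠ 0) :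
    ∃ (β : ℤ × ℕ → ℝ≥0∞) (z : ℤ × ℕ → EuclideanSpace ℝ (Fin n)) (l : ℤ × ℕ → ℤ),
      (∀ y, ENNReal.ofReal (u y) ^ θ⁻¹ ≤
        ∑' i, β i * (Metric.ball (z i) ((2 : ℝ) ^ l i)).indicator 1 y) ∧
      ∑' i, β i ^ θ * 2 ^ ((l i : ℝ) * δ) ≤ 2 * 2 ^ δ * (2 * choquet n δ univ u + ε) := by
  obtain ⟨ε', hε', hsum⟩ := ENNReal.exists_pos_sum_of_countable' hε ℤ
  have hpow0 : ∀ k : ℤ, (2 : ℝ≥0∞) ^ (k : ℝ) ≠ 0 := fun k =>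
    (ENNReal.rpow_pos (by norm_num) (by norm_num)).ne'
  have hpowt : ∀ k : ℤ, (2 : ℝ≥0∞) ^ (k : ℝ) ≠ ∞ := fun k =>
    ENNReal.rpow_ne_top_of_ne_zero (by norm_num) (by norm_num)
  have hfin : ∀ k : ℤ, hContent n δ {x | (2 : ℝ) ^ k < u x} ≠ ∞ := by
    intro k hk
    have h1 := (ENNReal.le_tsum k).trans (tsum_hContent_superlevel_le n δ u)
    rw [hk, ENNReal.mul_top (hpow0 k)] at h1
    exact ENNReal.mul_ne_top (by norm_num) hu (top_le_iff.1 h1)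
  have hcover : ∀ k : ℤ, ∃ (x : ℕ → EuclideanSpace ℝ (Fin n)) (r : ℕ → ℝ≥0),
      {x | (2 : ℝ) ^ k < u x} ⊆ ⋃ i, Metric.ball (x i) (r i) ∧
      ∑' i, (r i : ℝ≥0∞) ^ δ ≤
        hContent n δ {x | (2 : ℝ) ^ k < u x} + ε' k / 2 ^ (k : ℝ) := by
    intro k
    have h : hContent n δ {x | (2 : ℝ) ^ k < u x} <
        hContent n δ {x | (2 : ℝ) ^ k < u x} + ε' k / 2 ^ (k : ℝ) :=
      ENNReal.lt_add_right (hfin k) (ENNReal.div_pos (hε' k).ne' (hpowt k)).ne'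
    conv_lhs at h => rw [hContent]
    simp only [iInf_lt_iff] at h
    obtain ⟨x, r, hxr, hlt⟩ := h
    exact ⟨x, r, hxr, hlt.le⟩
  choose x r hxr hlt using hcover
  have hdyadic : ∀ i : ℤ × ℕ, ∃ (b : ℝ≥0∞) (l : ℤ),
      (∀ y ∈ Metric.ball (x i.1 i.2) (r i.1 i.2),
        y ∈ Metric.ball (x i.1 i.2) ((2 : ℝ) ^ l) ∧ ((2 : ℝ≥0∞) ^ ((i.1 : ℝ) + 1)) ^ θ⁻¹ ≤ b) ∧
      b ^ θ * 2 ^ ((l : ℝ) * δ) ≤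
        2 * 2 ^ δ * (2 ^ (i.1 : ℝ) * (r i.1 i.2 : ℝ≥0∞) ^ δ) := by
    rintro ⟨k, j⟩
    rcases eq_or_ne (r k j) 0 with h0 | h0
    · exact ⟨0, 0, by simp [h0], by simp [hθ]⟩
    · obtain ⟨l, hl1, hl2⟩ := exists_mem_Ioc_zpow
        (NNReal.coe_pos.2 (pos_iff_ne_zero.2 h0)) one_lt_two
      refine ⟨((2 : ℝ≥0∞) ^ ((k : ℝ) + 1)) ^ θ⁻¹, l + 1,
        fun y hy => ⟨Metric.ball_subset_ball hl2 hy, le_rfl⟩, ?_⟩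
      have hl : (2 : ℝ≥0∞) ^ (l : ℝ) ≤ r k j := by
        rw [ENNReal.rpow_intCast]
        have : (2 : ℝ≥0) ^ l ≤ r k j := by
          rw [← NNReal.coe_le_coe]; push_cast; exact hl1.le
        have h2 : ((2 : ℝ≥0) : ℝ≥0∞) ^ l ≤ r k j := by
          rw [← ENNReal.coe_zpow two_ne_zero]; exact_mod_cast this
        exact_mod_cast h2
      rw [ENNReal.rpow_inv_rpow hθ.ne']
      calc _ = 2 * 2 ^ δ * ((2 : ℝ≥0∞) ^ (k : ℝ) * ((2 : ℝ≥0∞) ^ (l : ℝ)) ^ δ) := by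
            rw [← ENNReal.rpow_mul, ENNReal.rpow_add _ _ (by norm_num) (by norm_num)]
            push_cast
            rw [add_mul, one_mul, ENNReal.rpow_add _ _ (by norm_num) (by norm_num),
              ENNReal.rpow_one]
            ring
        _ ≤ _ := by gcongr
  choose β l hβ1 hβ2 using hdyadic
  refine ⟨β, fun i => x i.1 i.2, l, fun y => ?_, ?_⟩
  · rcases le_or_gt (u y) 0 with h0 | h0
    · simp [ENNReal.ofReal_of_nonpos h0, hθ]
    · obtain ⟨k, hk1, hk2⟩ := exists_mem_Ioc_zpow h0 one_lt_two
      obtain ⟨j, hj⟩ := mem_iUnion.1 (hxr k hk1)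
      obtain ⟨hb1, hb2⟩ := hβ1 (k, j) y hj
      calc ENNReal.ofReal (u y) ^ θ⁻¹ ≤ ((2 : ℝ≥0∞) ^ ((k : ℝ) + 1)) ^ θ⁻¹ := by
            gcongr
            have h3 : (2 : ℝ≥0∞) = ENNReal.ofReal 2 := by norm_num
            rw [h3, ENNReal.ofReal_rpow_of_pos two_pos]
            refine ENNReal.ofReal_le_ofReal ?_
            exact_mod_cast hk2
        _ ≤ β (k, j) := hb2
        _ = β (k, j) * (Metric.ball (x k j) ((2 : ℝ) ^ l (k, j))).indicator 1 y := by
            rw [indicator_of_mem hb1]; simp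
        _ ≤ _ := ENNReal.le_tsum (f := fun i : ℤ × ℕ =>
            β i * (Metric.ball (x i.1 i.2) ((2 : ℝ) ^ l i)).indicator 1 y) (k, j)
  · refine (ENNReal.tsum_le_tsum hβ2).trans ?_
    rw [ENNReal.tsum_mul_left]
    gcongr
    rw [ENNReal.tsum_prod (f := fun (k : ℤ) (j : ℕ) => (2 : ℝ≥0∞) ^ (k : ℝ) * (r k j : ℝ≥0∞) ^ δ)]
    calc _ ≤ ∑' k : ℤ, ((2 : ℝ≥0∞) ^ (k : ℝ) * hContent n δ {x | (2 : ℝ) ^ k < u x} + ε' k) := by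
          refine ENNReal.tsum_le_tsum fun k => ?_
          rw [ENNReal.tsum_mul_left]
          refine (mul_le_mul_right (hlt k) _).trans ?_
          rw [mul_add, ENNReal.mul_div_cancel (hpow0 k) (hpowt k)]
      _ ≤ _ := by
          rw [ENNReal.tsum_add]
          exact add_le_add (tsum_hContent_superlevel_le n δ u) hsum.le

theorem echoquet_maximal_le_of_majorant {n : ℕ} (hn : n ≠ 0) {δ s θ : ℝ} (hδ : 0 < δ)
    (hs : 1 ≤ s) (hθ : 0 < θ) (hθ1 : θ ≤ 1) {f : EuclideanSpace ℝ (Fin n) → ℝ}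
    (hf : AEMeasurable f) {ι : Type*} [Countable ι] (β : ι → ℝ≥0∞)
    (z : ι → EuclideanSpace ℝ (Fin n)) (l : ι → ℤ)
    (hcov : ∀ y, ENNReal.ofReal |f y| ^ s ≤
      ∑' i, β i * (Metric.ball (z i) ((2 : ℝ) ^ l i)).indicator 1 y) :
    echoquet n δ univ (fun x => fracMaximal n 0 f x ^ (s * θ)) ≤
      ((n : ℝ≥0∞) + 1) ^ δ *
        (((volume (Metric.ball (0 : EuclideanSpace ℝ (Fin n)) 1) ^ (s - 1)) ^ θ *
          (volume (Metric.ball (0 : EuclideanSpace ℝ (Fin n)) 1) * 4 ^ n) ^ θ) *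
        (3 ^ n * (∑' j : ℤ, geomKernel (n * θ) j * 2 ^ ((j : ℝ) * δ)) *
          ∑' i, β i ^ θ * 2 ^ ((l i : ℝ) * δ))) := by
  have hp : 0 < s * θ := by positivity
  set D := (volume (Metric.ball (0 : EuclideanSpace ℝ (Fin n)) 1) ^ (s - 1)) ^ θ *
      (volume (Metric.ball (0 : EuclideanSpace ℝ (Fin n)) 1) * 4 ^ n) ^ θ with hD
  let w : ℤ → (Fin n → ℤ) → ℝ≥0∞ := fun k m => D * ∑' i, β i ^ θ *
    (geomKernel (n * θ) (k - l i) * (dyadicNhd k (z i) : Set (Fin n → ℤ)).indicator 1 m)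
  have hpt : ∀ x, fracMaximal n 0 f x ^ (s * θ) ≤ ∑' k, w k (dyadicIndex k x) := by
    intro x
    rw [← ENNReal.le_rpow_inv_iff hp, fracMaximal]
    refine iSup₂_le fun r hr => ?_
    rw [ENNReal.le_rpow_inv_iff hp]
    refine (average_rpow_le hs hθ hθ1 hf.abs.ennreal_ofReal β z l hcov x hr).trans_eq ?_
    simp only [w]
    rw [ENNReal.tsum_mul_left, ENNReal.tsum_comm]
    simp_rw [ENNReal.tsum_mul_left]
    rfl
  calc _ ≤ ∫⁻ t in Ioi (0 : ℝ),
        hContent n δ {x | ENNReal.ofReal t < ∑' k, w k (dyadicIndex k x)} :=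
        lintegral_mono fun t => hContent_mono fun x hx => hx.2.trans_le (hpt x)
    _ ≤ _ := lintegral_hContent_dyadic_le hn hδ w
    _ = ((n : ℝ≥0∞) + 1) ^ δ * ∑' Q : ℤ × (Fin n → ℤ), ∑' i, D * (β i ^ θ *
          (geomKernel (n * θ) (Q.1 - l i) *
            (dyadicNhd Q.1 (z i) : Set (Fin n → ℤ)).indicator 1 Q.2 * 2 ^ ((Q.1 : ℝ) * δ))) := by
        congr 1
        refine tsum_congr fun Q => ?_
        rw [ENNReal.tsum_mul_left]
        simp only [w]
        rw [mul_assoc, ← ENNReal.tsum_mul_right]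
        simp only [mul_assoc]
    _ = ((n : ℝ≥0∞) + 1) ^ δ * ∑' i, D * (β i ^ θ *
          (3 ^ n * (∑' j : ℤ, geomKernel (n * θ) j * 2 ^ ((j : ℝ) * δ)) *
            2 ^ ((l i : ℝ) * δ))) := by
        rw [ENNReal.tsum_comm]
        simp_rw [ENNReal.tsum_mul_left, tsum_dyadicNhd_geomKernel]
    _ = _ := by
        rw [ENNReal.tsum_mul_left, ← ENNReal.tsum_mul_left (a := 3 ^ n * _)]
        congr 2
        refine tsum_congr fun i => ?_
        ring

/-- Adams–Orobitg–Verdera: boundedness of the centered Hardy–Littlewood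
maximal operator in the sense of Choquet integrals w.r.t. the Hausdorff content. For
`0 < δ < n` and `p > δ/n` there is `c = c(n, δ, p)` such that for every `f ∈ L¹_loc(ℝⁿ)`,
`∫_{ℝⁿ} (Mf)^p dH^δ_∞ ≤ c ∫_{ℝⁿ} |f|^p dH^δ_∞`. -/
theorem maximal_bounded_choquet (n : ℕ) (hn : 2 ≤ n) (δ p : ℝ)
    (hδ0 : 0 < δ) (hδn : δ < (n : ℝ)) (hp : δ / n < p) :
    ∃ c : ℝ≥0, 0 < c ∧
      ∀ f : EuclideanSpace ℝ (Fin n) → ℝ, LocallyIntegrable f volume →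
        echoquet n δ Set.univ (fun x => fracMaximal n 0 f x ^ p)
          ≤ c * choquet n δ Set.univ fun x => |f x| ^ p := by
  have hn0 : (0 : ℝ) < n := by exact_mod_cast (by omega : 0 < n)
  have hp0 : 0 < p := (by positivity : 0 < δ / n).trans hp
  set θ := min 1 p with hθdef
  have hθ : 0 < θ := lt_min one_pos hp0
  have hθ1 : θ ≤ 1 := min_le_left _ _
  have hs : 1 ≤ p / θ := (one_le_div hθ).2 (min_le_right _ _)
  have hα : δ < n * θ := by
    rw [div_lt_iff₀ hn0] at hp
    rcases min_choice 1 p with h | h <;> rw [hθdef, h] <;> linarith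
  set v := volume (Metric.ball (0 : EuclideanSpace ℝ (Fin n)) 1) with hv
  have hvt : v ≠ ∞ := measure_ball_lt_top.ne
  set A := ∑' j : ℤ, geomKernel (n * θ) j * 2 ^ ((j : ℝ) * δ) with hA
  have hAt : A ≠ ∞ := tsum_geomKernel_ne_top hα
  set K : ℝ≥0∞ := ((n : ℝ≥0∞) + 1) ^ δ * (((v ^ (p / θ - 1)) ^ θ * (v * 4 ^ n) ^ θ) *
    (3 ^ n * A * (2 * 2 ^ δ))) with hK
  have hKt : K ≠ ∞ := by
    have h1 : ((n : ℝ≥0∞) + 1) ^ δ ≠ ∞ := ENNReal.rpow_ne_top_of_nonneg hδ0.le (by simp)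
    have h2 : (v ^ (p / θ - 1)) ^ θ ≠ ∞ := ENNReal.rpow_ne_top_of_nonneg hθ.le
      (ENNReal.rpow_ne_top_of_nonneg (by linarith) hvt)
    have h3 : (v * 4 ^ n) ^ θ ≠ ∞ := ENNReal.rpow_ne_top_of_nonneg hθ.le
      (ENNReal.mul_ne_top hvt (by simp))
    have h4 : (2 : ℝ≥0∞) ^ δ ≠ ∞ := ENNReal.rpow_ne_top_of_nonneg hδ0.le (by simp)
    exact ENNReal.mul_ne_top h1 (ENNReal.mul_ne_top (ENNReal.mul_ne_top h2 h3)
      (ENNReal.mul_ne_top (ENNReal.mul_ne_top (by simp) hAt) (ENNReal.mul_ne_top (by simp) h4)))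
  lift K to ℝ≥0 using hKt with K'
  refine ⟨2 * K' + 1, by positivity, fun f hf => ?_⟩
  set I := choquet n δ univ fun x => |f x| ^ p with hI
  rcases eq_or_ne I ∞ with hIt | hIt
  · rw [hIt, ENNReal.mul_top]
    · exact le_top
    · simp
  have hfm : AEMeasurable f := hf.aestronglyMeasurable.aemeasurable
  have hbound : ∀ ε : ℝ≥0∞, ε ≠ 0 →
      echoquet n δ Set.univ (fun x => fracMaximal n 0 f x ^ p) ≤ K' * (2 * I + ε) := by
    intro ε hε
    obtain ⟨β, z, l, hcov, hsum⟩ := exists_ball_majorant hδ0 hθ hIt hε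
    have h := echoquet_maximal_le_of_majorant (by omega) hδ0 hs hθ hθ1 hfm β z l (fun y => by
      refine le_trans (le_of_eq ?_) (hcov y)
      rw [← ENNReal.ofReal_rpow_of_nonneg (abs_nonneg _) hp0.le, ← ENNReal.rpow_mul,
        div_eq_mul_inv])
    rw [div_mul_cancel₀ _ hθ.ne'] at h
    refine h.trans ?_
    rw [hK]
    calc _ ≤ ((n : ℝ≥0∞) + 1) ^ δ * (((v ^ (p / θ - 1)) ^ θ * (v * 4 ^ n) ^ θ) *
          (3 ^ n * A * (2 * 2 ^ δ * (2 * I + ε)))) := by gcongr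
      _ = _ := by ring
  refine ENNReal.le_of_forall_pos_le_add fun ε hε _ => ?_
  have hε' : (ε : ℝ≥0∞) / (K' + 1) ≠ 0 :=
    (ENNReal.div_pos (by simpa using hε.ne') (by simp)).ne'
  refine (hbound _ hε').trans ?_
  rw [mul_add]
  refine add_le_add ?_ ?_
  · rw [← mul_assoc]
    gcongr
    push_cast
    rw [mul_comm]
    exact le_self_add
  · exact (mul_le_mul_left le_self_add _).trans ENNReal.mul_div_le
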